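/- Let λ, μ ∈ P^+ and τ ∈ T. Then for every β ∈ WΠ ∩ Q^+, β^∨(τμ) > 0 implies β^∨(τλ) ≥ 0. -/

import Mathlib

namespace GKM

variable {I V : Type*} [AddCommGroup V] [Module ℚ V]

/-- The simple "reflection" `r_i : x ↦ x - α_i^∨(x) • α_i` (an endomorphism of `h*`). -/
def srefl (α : I → V) (coroot : I → (V →ₗ[ℚ] ℚ)) (i : I) : Module.End ℚ V :=
  LinearMap.id - (coroot i).smulRight (α i)

/-- The dual map `h ↦ h - h(α_i) • α_i^∨` on linear functionals; for a real index `i`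
this is `r_i^∨ : h ↦ h ∘ r_i⁻¹ = h ∘ r_i`. -/
def crefl (α : I → V) (coroot : I → (V →ₗ[ℚ] ℚ)) (i : I) :
    Module.End ℚ (V →ₗ[ℚ] ℚ) :=
  LinearMap.id - (LinearMap.applyₗ (α i)).smulRight (coroot i)

/-- The monoid `T` generated by all the `r_i`, `i ∈ I`. -/
def Tmon (α : I → V) (coroot : I → (V →ₗ[ℚ] ℚ)) : Submonoid (Module.End ℚ V) :=
  Submonoid.closure (Set.range (srefl α coroot))

/-- The Weyl group `W` generated by the `r_i` with `i` real; since each generator is an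
involution, the submonoid it generates coincides with the group it generates. -/
def Wmon (A : I → I → ℤ) (α : I → V) (coroot : I → (V →ₗ[ℚ] ℚ)) :
    Submonoid (Module.End ℚ V) :=
  Submonoid.closure (srefl α coroot '' {i | A i i = 2})

/-- `Q^+`, the set of `ℕ`-linear combinations of simple roots. -/
def Qplus (α : I → V) : Set V :=
  {x | ∃ c : I →₀ ℕ, x = c.sum fun i n => (n : ℚ) • α i}

/-- The weight lattice `P`. -/
def Pint (coroot : I → (V →ₗ[ℚ] ℚ)) : Set V :=
  {x | ∀ i, ∃ n : ℤ, coroot i x = (n : ℚ)}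

/-- The dominant integral weights `P^+`. -/
def Pplus (coroot : I → (V →ₗ[ℚ] ℚ)) : Set V :=
  {x | (∀ i, ∃ n : ℤ, coroot i x = (n : ℚ)) ∧ ∀ i, 0 ≤ coroot i x}

/-- The orbit `Tλ`. -/
def Torbit (α : I → V) (coroot : I → (V →ₗ[ℚ] ℚ)) (lam : V) : Set V :=
  {x | ∃ τ, τ ∈ Tmon α coroot ∧ τ lam = x}

/-- The reduced length of `τ ∈ T` with respect to all generators `r_i`, `i ∈ I`. -/
noncomputable def lenT (α : I → V) (coroot : I → (V →ₗ[ℚ] ℚ))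
    (τ : Module.End ℚ V) : ℕ :=
  sInf {n | ∃ l : List I, l.length = n ∧ (l.map (srefl α coroot)).prod = τ}

/-- The reduced length of `w ∈ W` with respect to the real generators. -/
noncomputable def lenW (A : I → I → ℤ) (α : I → V) (coroot : I → (V →ₗ[ℚ] ℚ))
    (w : Module.End ℚ V) : ℕ :=
  sInf {n | ∃ l : List I, (∀ m ∈ l, A m m = 2) ∧ l.length = n ∧
    (l.map (srefl α coroot)).prod = w}

/-- The reflection `r_β : x ↦ x - β^∨(x) • β` attached to a root/coroot pair. -/
def reflRoot (β : V) (βv : V →ₗ[ℚ] ℚ) : Module.End ℚ V :=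
  LinearMap.id - βv.smulRight β

/-- A presentation of `β = w α_k ∈ WΠ` together with its coroot `β^∨ = w^∨ α_k^∨`,
via a word `l` (with real entries) for `w`. -/
def IsWRootPres (A : I → I → ℤ) (α : I → V) (coroot : I → (V →ₗ[ℚ] ℚ))
    (l : List I) (k : I) (β : V) (βv : V →ₗ[ℚ] ℚ) : Prop :=
  (∀ m ∈ l, A m m = 2) ∧
  β = (l.map (srefl α coroot)).prod (α k) ∧
  βv = (l.map (crefl α coroot)).prod (coroot k)

/-- `β ∈ WΠ` with coroot `β^∨`. -/
def IsWRootPair (A : I → I → ℤ) (α : I → V) (coroot : I → (V →ₗ[ℚ] ℚ))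
    (β : V) (βv : V →ₗ[ℚ] ℚ) : Prop :=
  ∃ l k, IsWRootPres A α coroot l k β βv

/-- A chain `ν =: c s ← ⋯ ← c 0 := μ` of length `s` inside `Tλ`:
`c k = r_{β k} (c (k+1))` with `β k ∈ WΠ ∩ Q^+` and `(β k)^∨(c (k+1)) > 0`. -/
def IsChain (A : I → I → ℤ) (α : I → V) (coroot : I → (V →ₗ[ℚ] ℚ))
    (lam μ ν : V) (s : ℕ) (c : ℕ → V) (β : ℕ → V)
    (βv : ℕ → (V →ₗ[ℚ] ℚ)) : Prop :=
  c 0 = μ ∧ c s = ν ∧ (∀ k ≤ s, c k ∈ Torbit α coroot lam) ∧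
  ∀ k < s, IsWRootPair A α coroot (β k) (βv k) ∧ β k ∈ Qplus α ∧
    0 < βv k (c (k+1)) ∧ c k = c (k+1) - βv k (c (k+1)) • β k

/-- `μ > ν` in `Tλ`. -/
def ChainGT (A : I → I → ℤ) (α : I → V) (coroot : I → (V →ₗ[ℚ] ℚ))
    (lam μ ν : V) : Prop :=
  ∃ s, 1 ≤ s ∧ ∃ c β βv, IsChain A α coroot lam μ ν s c β βv

/-- `dist(μ, ν) = n`: there is a chain of length `n` from `μ` to `ν` and every chain
has length at most `n`. -/
def distEq (A : I → I → ℤ) (α : I → V) (coroot : I → (V →ₗ[ℚ] ℚ))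
    (lam μ ν : V) (n : ℕ) : Prop :=
  (∃ c β βv, IsChain A α coroot lam μ ν n c β βv) ∧
  ∀ m c β βv, IsChain A α coroot lam μ ν m c β βv → m ≤ n

/-- An `a`-chain for `(μ, ν)`: a chain in which each step is a covering
(`dist = 1`), `a·β_k^∨(ν_k)` is a positive integer for steps along `WΠ_re`,
and `a·β_k^∨(ν_k) = 1` for steps along `WΠ_im`.  The index `ks k` records the simple
root of which `β k` is a `W`-translate. -/
def IsAChain (A : I → I → ℤ) (α : I → V) (coroot : I → (V →ₗ[ℚ] ℚ))
    (lam : V) (a : ℚ) (μ ν : V) (s : ℕ) (c : ℕ → V)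
    (β : ℕ → V) (βv : ℕ → (V →ₗ[ℚ] ℚ)) (ks : ℕ → I) : Prop :=
  1 ≤ s ∧ IsChain A α coroot lam μ ν s c β βv ∧
  ∀ k < s,
    (∃ l, IsWRootPres A α coroot l (ks k) (β k) (βv k)) ∧
    distEq A α coroot lam (c k) (c (k+1)) 1 ∧
    (A (ks k) (ks k) = 2 → ∃ n : ℕ, 0 < n ∧ a * βv k (c (k+1)) = (n : ℚ)) ∧
    (A (ks k) (ks k) ≠ 2 → a * βv k (c (k+1)) = 1)

/-- Existence of an `a`-chain for `(μ, ν)`. -/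
def HasAChain (A : I → I → ℤ) (α : I → V) (coroot : I → (V →ₗ[ℚ] ℚ))
    (lam : V) (a : ℚ) (μ ν : V) : Prop :=
  ∃ s c β βv ks, IsAChain A α coroot lam a μ ν s c β βv ks

/-- The piecewise-linear path attached to GLS data `(λ_1, …, λ_s ; a_0, …, a_s)`
(weights indexed `1, …, s`, breakpoints indexed `0, …, s`):
on `[a_{j-1}, a_j]` it equals `Σ_{k<j} (a_k - a_{k-1}) • λ_k + (t - a_{j-1}) • λ_j`. -/
def glsPath (lamseq : ℕ → V) (a : ℕ → ℚ) (s : ℕ) (t : ℚ) : V :=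
  ∑ k ∈ Finset.range s, (max (min t (a (k+1)) - a k) 0) • lamseq (k+1)

/-- The data of a Generalized Lakshmibai–Seshadri path of shape `lam`. -/
def IsGLS (A : I → I → ℤ) (α : I → V) (coroot : I → (V →ₗ[ℚ] ℚ))
    (lam : V) (s : ℕ) (lamseq : ℕ → V) (a : ℕ → ℚ) : Prop :=
  1 ≤ s ∧ a 0 = 0 ∧ a s = 1 ∧ (∀ k < s, a k < a (k+1)) ∧
  (∀ k, 1 ≤ k → k ≤ s → lamseq k ∈ Torbit α coroot lam) ∧
  (∀ k, 1 ≤ k → k < s →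
    HasAChain A α coroot lam (a k) (lamseq k) (lamseq (k+1))) ∧
  (lamseq s = lam ∨ HasAChain A α coroot lam 1 (lamseq s) lam)

/-- The set `ℙ_λ` of Generalized Lakshmibai–Seshadri paths of shape `lam`,
realized as functions `ℚ → V` via `glsPath`. -/
def GLSset (A : I → I → ℤ) (α : I → V) (coroot : I → (V →ₗ[ℚ] ℚ))
    (lam : V) : Set (ℚ → V) :=
  {π | ∃ s lamseq a, IsGLS A α coroot lam s lamseq a ∧ π = glsPath lamseq a s}

/-- `h_i^π(t) = α_i^∨(π(t))`. -/
def hFun (coroot : I → (V →ₗ[ℚ] ℚ)) (i : I) (π : ℚ → V) (t : ℚ) : ℚ :=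
  coroot i (π t)

/-- `m_i^π`, the minimal integer value attained by `h_i^π` on `[0,1]`. -/
noncomputable def mOf (coroot : I → (V →ₗ[ℚ] ℚ)) (i : I) (π : ℚ → V) : ℤ :=
  sInf {n : ℤ | ∃ t, 0 ≤ t ∧ t ≤ 1 ∧ hFun coroot i π t = (n : ℚ)}

/-- Two paths agree on `[0,1]`. -/
def pathEq (π π' : ℚ → V) : Prop := ∀ t, 0 ≤ t → t ≤ 1 → π t = π' t

/-- `tp = f_+^i(π)`: the largest point of `[0,1]` where `h_i^π` equals `m_i^π`. -/
def IsFPlus (coroot : I → (V →ₗ[ℚ] ℚ)) (i : I) (π : ℚ → V) (tp : ℚ) : Prop :=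
  0 ≤ tp ∧ tp ≤ 1 ∧ hFun coroot i π tp = (mOf coroot i π : ℚ) ∧
  ∀ t, 0 ≤ t → t ≤ 1 → hFun coroot i π t = (mOf coroot i π : ℚ) → t ≤ tp

/-- `tm = f_-^i(π)`: the smallest point of `[tp,1]` where `h_i^π` equals `m_i^π + 1`. -/
def IsFMinus (coroot : I → (V →ₗ[ℚ] ℚ)) (i : I) (π : ℚ → V) (tp tm : ℚ) : Prop :=
  tp ≤ tm ∧ tm ≤ 1 ∧ hFun coroot i π tm = (mOf coroot i π : ℚ) + 1 ∧
  ∀ t, tp ≤ t → t ≤ 1 → hFun coroot i π t = (mOf coroot i π : ℚ) + 1 → tm ≤ t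

/-- The path `f_i π` (for cutting data `tp = f_+^i(π)`, `tm = f_-^i(π)`). -/
def fPath (α : I → V) (coroot : I → (V →ₗ[ℚ] ℚ)) (i : I) (tp tm : ℚ)
    (π : ℚ → V) (t : ℚ) : V :=
  if t ≤ tp then π t
  else if t ≤ tm then π tp + srefl α coroot i (π t - π tp)
  else π t - α i

/-- `π' = f_i π ≠ 0` (equality of paths on `[0,1]`). -/
def FRel (α : I → V) (coroot : I → (V →ₗ[ℚ] ℚ)) (i : I) (π π' : ℚ → V) : Prop :=
  ∃ tp tm, IsFPlus coroot i π tp ∧ tp < 1 ∧ IsFMinus coroot i π tp tm ∧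
    pathEq π' (fPath α coroot i tp tm π)

/-- `tp = e_+^i(π)` (`i` real): smallest point of `[0,1]` where `h_i^π = m_i^π`. -/
def IsEPlusRe (coroot : I → (V →ₗ[ℚ] ℚ)) (i : I) (π : ℚ → V) (tp : ℚ) : Prop :=
  0 ≤ tp ∧ tp ≤ 1 ∧ hFun coroot i π tp = (mOf coroot i π : ℚ) ∧
  ∀ t, 0 ≤ t → t ≤ 1 → hFun coroot i π t = (mOf coroot i π : ℚ) → tp ≤ t

/-- `tm = e_-^i(π)` (`i` real): largest point of `[0,tp]` where `h_i^π = m_i^π + 1`. -/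
def IsEMinusRe (coroot : I → (V →ₗ[ℚ] ℚ)) (i : I) (π : ℚ → V) (tp tm : ℚ) : Prop :=
  0 ≤ tm ∧ tm ≤ tp ∧ hFun coroot i π tm = (mOf coroot i π : ℚ) + 1 ∧
  ∀ t, 0 ≤ t → t ≤ tp → hFun coroot i π t = (mOf coroot i π : ℚ) + 1 → t ≤ tm

/-- The path `e_i π` for `i` real. -/
def ePathRe (α : I → V) (coroot : I → (V →ₗ[ℚ] ℚ)) (i : I) (tm tp : ℚ)
    (π : ℚ → V) (t : ℚ) : V :=
  if t ≤ tm then π t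
  else if t ≤ tp then π tm + srefl α coroot i (π t - π tm)
  else π t + α i

/-- `π' = e_i π ≠ 0` for a real index `i`. -/
def ERelRe (α : I → V) (coroot : I → (V →ₗ[ℚ] ℚ)) (i : I) (π π' : ℚ → V) : Prop :=
  ∃ tp tm, IsEPlusRe coroot i π tp ∧ 0 < tp ∧ IsEMinusRe coroot i π tp tm ∧
    pathEq π' (ePathRe α coroot i tm tp π)

/-- The "inverse reflection" `r_i^{-1} : x ↦ x + (1/(1-a_{ii})) α_i^∨(x) α_i`
for an imaginary index `i`. -/
def rinv (A : I → I → ℤ) (α : I → V) (coroot : I → (V →ₗ[ℚ] ℚ)) (i : I) :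
    Module.End ℚ V :=
  LinearMap.id + (1 / (1 - (A i i : ℚ))) • (coroot i).smulRight (α i)

/-- `tp = e_+^i(π)` (`i` imaginary): smallest point of `[tm,1]` where
`h_i^π = m_i^π + 1 - a_{ii}` (here `tm = e_-^i(π) = f_+^i(π)`). -/
def IsEPlusIm (A : I → I → ℤ) (coroot : I → (V →ₗ[ℚ] ℚ)) (i : I) (π : ℚ → V)
    (tm tp : ℚ) : Prop :=
  tm ≤ tp ∧ tp ≤ 1 ∧
  hFun coroot i π tp = (mOf coroot i π : ℚ) + 1 - (A i i : ℚ) ∧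
  ∀ t, tm ≤ t → t ≤ 1 →
    hFun coroot i π t = (mOf coroot i π : ℚ) + 1 - (A i i : ℚ) → tp ≤ t

/-- The path `e_i π` for `i` imaginary. -/
def ePathIm (A : I → I → ℤ) (α : I → V) (coroot : I → (V →ₗ[ℚ] ℚ)) (i : I)
    (tm tp : ℚ) (π : ℚ → V) (t : ℚ) : V :=
  if t ≤ tm then π t
  else if t ≤ tp then π tm + rinv A α coroot i (π t - π tm)
  else π t + α i

/-- `π' = e_i π ≠ 0` for an imaginary index `i`:  `e_-^i(π) = f_+^i(π) < 1`, the point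
`e_+^i(π)` exists, and `h_i^π` never drops to `m_i^π - a_{ii}` on `[e_+^i(π), 1]`. -/
def ERelIm (A : I → I → ℤ) (α : I → V) (coroot : I → (V →ₗ[ℚ] ℚ)) (i : I)
    (π π' : ℚ → V) : Prop :=
  ∃ tm tp, IsFPlus coroot i π tm ∧ tm < 1 ∧ IsEPlusIm A coroot i π tm tp ∧
    (∀ t, tp ≤ t → t ≤ 1 →
      (mOf coroot i π : ℚ) - (A i i : ℚ) < hFun coroot i π t) ∧
    pathEq π' (ePathIm A α coroot i tm tp π)

/-- `π' = e_i π ≠ 0`. -/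
def ERel (A : I → I → ℤ) (α : I → V) (coroot : I → (V →ₗ[ℚ] ℚ)) (i : I)
    (π π' : ℚ → V) : Prop :=
  (A i i = 2 ∧ ERelRe α coroot i π π') ∨ (A i i ≠ 2 ∧ ERelIm A α coroot i π π')

/-- `π' = f_{i_1} ⋯ f_{i_k} π ≠ 0` for a list `[i_1, …, i_k]` (rightmost acts first). -/
def FMonRel (α : I → V) (coroot : I → (V →ₗ[ℚ] ℚ)) :
    List I → (ℚ → V) → (ℚ → V) → Prop
  | [], π, π' => pathEq π π'
  | i :: l, π, π' => ∃ πm, FMonRel α coroot l π πm ∧ FRel α coroot i πm π'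

/-- A generalized crystal for the Borcherds–Cartan datum `(A, α, coroot)`. -/
structure GenCrystal (A : I → I → ℤ) (α : I → V)
    (coroot : I → (V →ₗ[ℚ] ℚ)) where
  B : Type*
  wt : B → V
  wt_int : ∀ (i : I) (b : B), ∃ n : ℤ, coroot i (wt b) = (n : ℚ)
  eps : I → B → WithBot ℤ
  phi : I → B → WithBot ℤ
  e : I → B → Option B
  f : I → B → Option B
  phi_eq : ∀ (i : I) (b : B) (n : ℤ), (n : ℚ) = coroot i (wt b) →
    phi i b = eps i b + (n : WithBot ℤ)
  wt_e : ∀ (i : I) (b b' : B), e i b = some b' → wt b' = wt b + α i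
  eps_e_re : ∀ (i : I) (b b' : B), A i i = 2 → e i b = some b' →
    eps i b' = eps i b + ((-1 : ℤ) : WithBot ℤ)
  eps_e_im : ∀ (i : I) (b b' : B), A i i ≠ 2 → e i b = some b' →
    eps i b' = eps i b
  e_iff_f : ∀ (i : I) (b b' : B), e i b = some b' ↔ f i b' = some b
  phi_bot : ∀ (i : I) (b : B), phi i b = ⊥ → e i b = none ∧ f i b = none
  eps_im : ∀ (i : I) (b : B), A i i ≠ 2 → eps i b ≤ 0
  phi_im : ∀ (i : I) (b : B), A i i ≠ 2 → phi i b = ⊥ ∨ 0 ≤ phi i b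

/-- Finite "orthogonal" subsets of the imaginary simple roots, encoded by their
index sets: `F ∈ 𝒫(Π_im)`. -/
def PImSet (A : I → I → ℤ) (F : Finset I) : Prop :=
  (∀ i ∈ F, A i i ≠ 2) ∧ ∀ i ∈ F, ∀ j ∈ F, i ≠ j → A i j = 0

end GKM

namespace GKM

open Finsupp (single)

section Lattice

variable {I : Type*}

/-- A generalized Cartan matrix, over an arbitrary index set. -/
structure IsGCM (A : I → I → ℤ) : Prop where
  diag : ∀ i, A i i = 2
  off : ∀ i j, i ≠ j → A i j ≤ 0
  zero : ∀ i j, A i j = 0 → A j i = 0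

/-- The functional `x ↦ ∑ j, A i j * x j`. -/
noncomputable def rowPairing (A : I → I → ℤ) (i : I) : (I →₀ ℤ) →ₗ[ℤ] ℤ :=
  Finsupp.linearCombination ℤ (A i)

/-- The bilinear form `(y, x) ↦ ∑ i j, y i * A i j * x j`. -/
noncomputable def latPairing (A : I → I → ℤ) : (I →₀ ℤ) →ₗ[ℤ] (I →₀ ℤ) →ₗ[ℤ] ℤ :=
  Finsupp.linearCombination ℤ (rowPairing A)

/-- The simple reflection on the root lattice. -/
noncomputable def latRefl (A : I → I → ℤ) (i : I) : Module.End ℤ (I →₀ ℤ) :=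
  LinearMap.id - (rowPairing A i).smulRight (single i 1)

/-- The simple reflection acting on the root lattice and the coroot lattice. -/
noncomputable def pairRefl (A : I → I → ℤ) (i : I) :
    Module.End ℤ (I →₀ ℤ) × Module.End ℤ (I →₀ ℤ) :=
  (latRefl A i, latRefl (fun i j => A j i) i)

/-- The action of a word of simple reflections on the root and coroot lattices. -/
noncomputable def wordAct (A : I → I → ℤ) (l : List I) :
    Module.End ℤ (I →₀ ℤ) × Module.End ℤ (I →₀ ℤ) :=
  (l.map (pairRefl A)).prod

/-- The root and the coroot obtained from the `k`-th simple ones are both positive. -/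
def PosAt (w : Module.End ℤ (I →₀ ℤ) × Module.End ℤ (I →₀ ℤ)) (k : I) : Prop :=
  0 ≤ w.1 (single k 1) ∧ 0 ≤ w.2 (single k 1)

/-- The root and the coroot obtained from the `k`-th simple ones are both negative. -/
def NegAt (w : Module.End ℤ (I →₀ ℤ) × Module.End ℤ (I →₀ ℤ)) (k : I) : Prop :=
  w.1 (single k 1) ≤ 0 ∧ w.2 (single k 1) ≤ 0

variable {A : I → I → ℤ}

lemma IsGCM.transpose (h : IsGCM A) : IsGCM (fun i j => A j i) :=
  ⟨h.diag, fun i j hij => h.off j i hij.symm, fun i j => h.zero j i⟩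

@[simp] lemma rowPairing_single (i j : I) (c : ℤ) : rowPairing A i (single j c) = c * A i j := by
  simp [rowPairing]

lemma latRefl_apply (i : I) (x : I →₀ ℤ) :
    latRefl A i x = x - rowPairing A i x • single i 1 := by
  simp [latRefl]

lemma latRefl_apply_of_ne {i j : I} (hij : j ≠ i) (x : I →₀ ℤ) : latRefl A i x j = x j := by
  simp [latRefl_apply, hij.symm]

lemma latRefl_apply_self (i : I) (x : I →₀ ℤ) :
    latRefl A i x i = x i - rowPairing A i x := by
  simp [latRefl_apply]

lemma latRefl_single_self (h : IsGCM A) (i : I) :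
    latRefl A i (single i 1) = -single i 1 := by
  rw [latRefl_apply, rowPairing_single, h.diag]
  module

lemma latRefl_mul_self (h : IsGCM A) (i : I) : latRefl A i * latRefl A i = 1 := by
  refine LinearMap.ext fun x => ?_
  simp only [Module.End.mul_apply, latRefl_apply, map_sub, map_smul, rowPairing_single, h.diag,
    Module.End.one_apply]
  module

lemma pairRefl_mul_self (h : IsGCM A) (i : I) : pairRefl A i * pairRefl A i = 1 :=
  Prod.ext (latRefl_mul_self h i) (latRefl_mul_self h.transpose i)

@[simp] lemma wordAct_nil : wordAct A [] = 1 := rfl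

@[simp] lemma wordAct_cons (i : I) (l : List I) :
    wordAct A (i :: l) = pairRefl A i * wordAct A l := by
  simp [wordAct]

@[simp] lemma wordAct_append (l l' : List I) :
    wordAct A (l ++ l') = wordAct A l * wordAct A l' := by
  simp [wordAct]

lemma wordAct_mul_reverse (h : IsGCM A) (l : List I) :
    wordAct A l * wordAct A l.reverse = 1 := by
  induction l with
  | nil => simp
  | cons i l ih =>
    simp only [wordAct_cons, List.reverse_cons, wordAct_append, wordAct_nil, mul_one]
    rw [mul_assoc, ← mul_assoc (wordAct A l), ih, one_mul, pairRefl_mul_self h]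

lemma wordAct_reverse_mul (h : IsGCM A) (l : List I) :
    wordAct A l.reverse * wordAct A l = 1 := by
  simpa using wordAct_mul_reverse h l.reverse

lemma latPairing_single_left (i : I) (x : I →₀ ℤ) :
    latPairing A (single i 1) x = rowPairing A i x := by
  simp [latPairing]

lemma latPairing_single_right (i : I) (y : I →₀ ℤ) :
    latPairing A y (single i 1) = rowPairing (fun i j => A j i) i y := by
  induction y using Finsupp.induction_linear with
  | zero => simp
  | add f g hf hg => simp [hf, hg]
  | single j c => simp [latPairing]

lemma latPairing_comm (x y : I →₀ ℤ) :
    latPairing A y x = latPairing (fun i j => A j i) x y := by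
  induction y using Finsupp.induction_linear with
  | zero => simp
  | add f g hf hg => simp [hf, hg]
  | single j c =>
    have h1 : (single j c : I →₀ ℤ) = c • single j 1 := by simp
    rw [h1, map_smul, map_smul, LinearMap.smul_apply, latPairing_single_left,
      latPairing_single_right]

lemma latPairing_latRefl (i : I) (x y : I →₀ ℤ) :
    latPairing A (latRefl (fun i j => A j i) i y) x = latPairing A y (latRefl A i x) := by
  simp only [latRefl_apply, map_sub, map_smul, LinearMap.sub_apply, LinearMap.smul_apply,
    latPairing_single_left, latPairing_single_right, smul_eq_mul]
  ring

lemma latPairing_wordAct (h : IsGCM A) (l : List I) (x y : I →₀ ℤ) :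
    latPairing A ((wordAct A l).2 y) ((wordAct A l).1 x) = latPairing A y x := by
  induction l with
  | nil => simp
  | cons i l ih =>
    simp only [wordAct_cons, Prod.fst_mul, Prod.snd_mul, Module.End.mul_apply, pairRefl]
    rw [latPairing_latRefl, ← Module.End.mul_apply, latRefl_mul_self h, Module.End.one_apply, ih]

/-- Conjugating a simple reflection gives a simple reflection as soon as the transformed root
and coroot are simple. -/
lemma pairRefl_mul_wordAct (h : IsGCM A) (l : List I) {s i : I}
    (h1 : (wordAct A l).1 (single s 1) = single i 1)
    (h2 : (wordAct A l).2 (single s 1) = single i 1) :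
    wordAct A l * pairRefl A s = pairRefl A i * wordAct A l := by
  refine Prod.ext (LinearMap.ext fun x => ?_) (LinearMap.ext fun y => ?_)
  · simp only [Prod.fst_mul, Module.End.mul_apply, pairRefl, latRefl_apply, map_sub, map_smul, h1]
    rw [← latPairing_single_left i, ← h2, latPairing_wordAct h, latPairing_single_left]
  · simp only [Prod.snd_mul, Module.End.mul_apply, pairRefl, latRefl_apply, map_sub, map_smul, h2]
    rw [← latPairing_single_right i, ← h1, latPairing_wordAct h, latPairing_single_right]

/-- If a positive vector becomes negative under `latRefl A i`, it is a multiple of the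
`i`-th simple vector. -/
lemma eq_single_of_latRefl_nonpos {i : I} {x : I →₀ ℤ} (hx : 0 ≤ x) (hr : latRefl A i x ≤ 0) :
    x = single i (x i) := by
  ext j
  by_cases hj : j = i
  · simp [hj]
  · have h1 := hr j
    rw [latRefl_apply_of_ne hj] at h1
    have h2 := hx j
    simp only [Finsupp.coe_zero, Pi.zero_apply] at h1 h2
    simp [Ne.symm hj, le_antisymm h1 h2]

lemma not_negAt_one (s : I) : ¬ NegAt (1 : Module.End ℤ (I →₀ ℤ) × Module.End ℤ (I →₀ ℤ)) s := by
  intro h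
  have := h.1 s
  simp at this

/-- The root and coroot of a word are simple if the next reflection makes them negative. -/
lemma simple_of_posAt_of_negAt (h : IsGCM A) {l : List I} {s i : I}
    (hp : PosAt (wordAct A l) s) (hn : NegAt (wordAct A (i :: l)) s) :
    (wordAct A l).1 (single s 1) = single i 1 ∧ (wordAct A l).2 (single s 1) = single i 1 := by
  have e1 := eq_single_of_latRefl_nonpos hp.1 (by simpa [pairRefl] using hn.1)
  have e2 := eq_single_of_latRefl_nonpos hp.2 (by simpa [pairRefl] using hn.2)
  have hB := latPairing_wordAct h l (single s 1) (single s 1)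
  have p1 := hp.1 i
  have p2 := hp.2 i
  simp only [Finsupp.coe_zero, Pi.zero_apply] at p1 p2
  generalize (wordAct A l).1 (single s 1) = x at *
  generalize (wordAct A l).2 (single s 1) = y at *
  generalize x i = c at *
  generalize y i = d at *
  subst e1 e2
  have hd : d * c = 1 := by
    have h1 : (single i d : I →₀ ℤ) = d • single i 1 := by simp
    rw [h1, map_smul, LinearMap.smul_apply, latPairing_single_left, latPairing_single_left,
      rowPairing_single, rowPairing_single, h.diag, h.diag, smul_eq_mul] at hB
    linarith
  have hc1 : c = 1 := Int.eq_one_of_mul_eq_one_left p1 hd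
  have hd1 : d = 1 := by simpa [hc1] using hd
  rw [hc1, hd1]
  exact ⟨rfl, rfl⟩

/-- The exchange property, for words all of whose shorter words are sign-coherent. -/
lemma exists_shorter_of_negAt (h : IsGCM A) (s : I) (l : List I)
    (hcoh : ∀ l' : List I, l'.length < l.length → PosAt (wordAct A l') s ∨ NegAt (wordAct A l') s)
    (hn : NegAt (wordAct A l) s) :
    ∃ l' : List I, l'.length < l.length ∧ wordAct A l' = wordAct A l * pairRefl A s := by
  induction l with
  | nil => exact absurd hn (by simpa using not_negAt_one s)
  | cons i l ih =>
    rcases hcoh l (by simp) with hp | hn'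
    · obtain ⟨h1, h2⟩ := simple_of_posAt_of_negAt h hp hn
      refine ⟨l, by simp, ?_⟩
      rw [wordAct_cons, mul_assoc, pairRefl_mul_wordAct h l h1 h2, ← mul_assoc,
        pairRefl_mul_self h, one_mul]
    · obtain ⟨l', hl', e⟩ := ih (fun l' hl' => hcoh l' (hl'.trans (by simp))) hn'
      exact ⟨i :: l', by simpa using hl', by rw [wordAct_cons, e, wordAct_cons, mul_assoc]⟩

/-- Sign-coherence in rank two. -/
lemma rank_two_coherent (h : IsGCM A) {s t : I} (hst : s ≠ t) (z : List I)
    (hz : ∀ i ∈ z, i = s ∨ i = t) :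
    ∃ p q p' q' : ℤ, (wordAct A z).1 (single s 1) = p • single s 1 + q • single t 1 ∧
      (wordAct A z).2 (single s 1) = p' • single s 1 + q' • single t 1 ∧
      ((0 ≤ p ∧ 0 ≤ q ∧ 0 ≤ p' ∧ 0 ≤ q') ∨ (p ≤ 0 ∧ q ≤ 0 ∧ p' ≤ 0 ∧ q' ≤ 0)) := by
  obtain ⟨a, ha⟩ : ∃ a, A s t = -a := ⟨-A s t, by ring⟩
  obtain ⟨b, hb⟩ : ∃ b, A t s = -b := ⟨-A t s, by ring⟩
  have ha0 : 0 ≤ a := by have := h.off s t hst; omega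
  have hb0 : 0 ≤ b := by have := h.off t s hst.symm; omega
  have hab : a = 0 → b = 0 := fun h0 => by have := h.zero s t (by omega); omega
  have hba : b = 0 → a = 0 := fun h0 => by have := h.zero t s (by omega); omega
  have key : ∃ p q q' : ℤ, (wordAct A z).1 (single s 1) = p • single s 1 + q • single t 1 ∧
      (wordAct A z).2 (single s 1) = p • single s 1 + q' • single t 1 ∧
      b * q' = a * q ∧ b * p ^ 2 - a * b * p * q + a * q ^ 2 = b ∧
      (a = 0 → q = 0 ∧ q' = 0) := by
    induction z with
    | nil => exact ⟨1, 0, 0, by simp⟩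
    | cons i z ih =>
      obtain ⟨p, q, q', e1, e2, e3, e4, e5⟩ := ih fun i hi => hz i (by simp [hi])
      simp only [wordAct_cons, Prod.fst_mul, Prod.snd_mul, Module.End.mul_apply, e1, e2, pairRefl]
      rcases hz i (by simp) with rfl | rfl
      · refine ⟨-p + a * q, q, q', ?_, ?_, e3, by linear_combination e4, e5⟩
        · simp only [latRefl_apply, map_add, map_smul, rowPairing_single, h.diag, ha]
          module
        · simp only [latRefl_apply, map_add, map_smul, rowPairing_single, h.diag, hb]
          rw [← e3]
          module
      · refine ⟨p, -q + b * p, -q' + a * p, ?_, ?_, by linear_combination -e3,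
          by linear_combination e4, fun h0 => ?_⟩
        · simp only [latRefl_apply, map_add, map_smul, rowPairing_single, h.diag, hb]
          module
        · simp only [latRefl_apply, map_add, map_smul, rowPairing_single, h.diag, ha]
          module
        · obtain ⟨rfl, rfl⟩ := e5 h0
          simp [h0, hab h0]
  obtain ⟨p, q, q', e1, e2, e3, e4, e5⟩ := key
  refine ⟨p, q, p, q', e1, e2, ?_⟩
  rcases eq_or_lt_of_le ha0 with h0 | h0
  · obtain ⟨rfl, rfl⟩ := e5 h0.symm
    rcases le_total 0 p with hp | hp <;> simp [hp]
  · have hb1 : 0 < b := lt_of_le_of_ne hb0 fun hb' => h0.ne' (hba hb'.symm)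
    have hq1 : 0 ≤ q → 0 ≤ q' := fun hq => by
      by_contra hq'
      nlinarith [mul_nonneg ha0 hq]
    have hq2 : q ≤ 0 → q' ≤ 0 := fun hq => by
      by_contra hq'
      nlinarith [mul_nonneg ha0 (neg_nonneg.2 hq)]
    have hpq : 0 ≤ p * q := by
      by_contra hneg
      have h1 : p * q ≤ -1 := by omega
      have hp : p ≠ 0 := by rintro rfl; simp at hneg
      have hp2 : 1 ≤ p ^ 2 := by have := pow_pos (abs_pos.2 hp) 2; rw [sq_abs] at this; omega
      nlinarith [mul_pos h0 hb1, mul_nonneg ha0 (sq_nonneg q)]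
    rcases mul_nonneg_iff.1 hpq with ⟨hp, hq⟩ | ⟨hp, hq⟩
    · exact Or.inl ⟨hp, hq, hp, hq1 hq⟩
    · exact Or.inr ⟨hp, hq, hp, hq2 hq⟩

/-- Every root of the form `w α_k` is positive or negative, and its coroot has the same sign. -/
theorem posAt_or_negAt (h : IsGCM A) (l : List I) (k : I) :
    PosAt (wordAct A l) k ∨ NegAt (wordAct A l) k := by
  induction hn : l.length using Nat.strong_induction_on generalizing l k with
  | _ n IH =>
  rcases List.eq_nil_or_concat l with rfl | ⟨l', t, rfl⟩
  · exact Or.inl (by simp [PosAt])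
  have hl' : l'.length < n := by simp [← hn]
  by_cases hk : k = t
  · subst hk
    have e1 : (wordAct A (l'.concat k)).1 (single k 1) = -(wordAct A l').1 (single k 1) := by
      simp [pairRefl, latRefl_single_self h]
    have e2 : (wordAct A (l'.concat k)).2 (single k 1) = -(wordAct A l').2 (single k 1) := by
      simp [pairRefl, latRefl_single_self h.transpose]
    unfold PosAt NegAt
    rw [e1, e2]
    simp only [Left.nonneg_neg_iff, Left.neg_nonpos_iff]
    exact (IH _ hl' l' k rfl).symm
  · classical
    let S : ℕ → Prop := fun m => ∃ v z : List I, v.length = m ∧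
      (∀ i ∈ z, i = k ∨ i = t) ∧ wordAct A (l'.concat t) = wordAct A v * wordAct A z
    have hS : S l'.length := ⟨l', [t], rfl, by simp, by simp⟩
    obtain ⟨v, z, hv, hz, e⟩ := Nat.find_spec ⟨_, hS⟩
    have hvl : v.length < n := hv ▸ (Nat.find_min' ⟨_, hS⟩ hS).trans_lt hl'
    have hpos : ∀ j, j = k ∨ j = t → PosAt (wordAct A v) j := fun j hj => by
      refine (IH _ hvl v j rfl).resolve_right fun hneg => ?_
      obtain ⟨v', hv', e'⟩ := exists_shorter_of_negAt h j v
        (fun u hu => IH _ (hu.trans hvl) u j rfl) hneg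
      refine Nat.find_min ⟨_, hS⟩ (hv ▸ hv') ⟨v', j :: z, rfl, ?_, ?_⟩
      · rintro i (_ | ⟨_, hi⟩)
        exacts [hj, hz i hi]
      · rw [e, e', wordAct_cons, mul_assoc, ← mul_assoc (pairRefl A j), pairRefl_mul_self h,
          one_mul]
    obtain ⟨p, q, p', q', e1, e2, hsign⟩ := rank_two_coherent h hk z hz
    obtain ⟨k1, k2⟩ := hpos k (Or.inl rfl)
    obtain ⟨t1, t2⟩ := hpos t (Or.inr rfl)
    unfold PosAt NegAt
    simp only [e, Prod.fst_mul, Prod.snd_mul, Module.End.mul_apply, e1, e2, map_add, map_smul]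
    rcases hsign with ⟨a1, a2, a3, a4⟩ | ⟨a1, a2, a3, a4⟩
    · exact Or.inl ⟨add_nonneg (smul_nonneg a1 k1) (smul_nonneg a2 t1),
        add_nonneg (smul_nonneg a3 k2) (smul_nonneg a4 t2)⟩
    · exact Or.inr ⟨add_nonpos (smul_nonpos_of_nonpos_of_nonneg a1 k1)
        (smul_nonpos_of_nonpos_of_nonneg a2 t1),
        add_nonpos (smul_nonpos_of_nonpos_of_nonneg a3 k2)
        (smul_nonpos_of_nonpos_of_nonneg a4 t2)⟩

lemma sum_pos_exists {ι : Type*} {f : ι → ℤ} {s : Finset ι} (h : 0 < ∑ i ∈ s, f i) :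
    ∃ i ∈ s, 0 < f i := by
  by_contra! hc
  exact absurd (Finset.sum_nonpos hc) (not_le.2 h)

lemma pos_of_rowPairing_pos (h : IsGCM A) {i : I} {x : I →₀ ℤ} (hx : 0 ≤ x)
    (hr : 0 < rowPairing A i x) : 0 < x i := by
  rw [rowPairing, Finsupp.linearCombination_apply, Finsupp.sum] at hr
  obtain ⟨j, -, hj⟩ := sum_pos_exists hr
  have h2 : 0 ≤ x j := hx j
  by_cases hij : i = j
  · subst hij
    rw [h.diag, smul_eq_mul] at hj
    omega
  · have := mul_nonpos_of_nonneg_of_nonpos h2 (h.off i j hij)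
    exact absurd hj (not_lt.2 this)

/-- The support of a positive coroot is contained in the support of its root. -/
theorem coroot_support_subset (h : IsGCM A) (l : List I) (k : I) (hp : PosAt (wordAct A l) k)
    (j : I) (hj : (wordAct A l).1 (single k 1) j = 0) : (wordAct A l).2 (single k 1) j = 0 := by
  induction hn : (((wordAct A l).1 (single k 1)).sum fun _ c => c).toNat
    using Nat.strong_induction_on generalizing l with
  | _ n IH =>
  obtain ⟨x, hx⟩ : ∃ x, (wordAct A l).1 (single k 1) = x := ⟨_, rfl⟩
  obtain ⟨y, hy⟩ : ∃ y, (wordAct A l).2 (single k 1) = y := ⟨_, rfl⟩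
  have hB := latPairing_wordAct h l (single k 1) (single k 1)
  have hp' := hp
  unfold PosAt at hp'
  rw [latPairing_single_left, rowPairing_single, h.diag] at hB
  rw [hx] at hj hn
  rw [hx, hy] at hB hp'
  rw [hy]
  have hB' : 0 < latPairing A y x := by omega
  rw [latPairing, Finsupp.linearCombination_apply, Finsupp.sum, LinearMap.sum_apply] at hB'
  obtain ⟨i, -, hi⟩ := sum_pos_exists hB'
  rw [LinearMap.smul_apply, smul_eq_mul] at hi
  have hri : 0 < rowPairing A i x := pos_of_mul_pos_right hi (hp'.2 i)
  have hxi := pos_of_rowPairing_pos h hp'.1 hri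
  have hji : j ≠ i := by rintro rfl; omega
  have c1 : (wordAct A (i :: l)).1 (single k 1) = latRefl A i x := by simp [pairRefl, hx]
  have c2 : (wordAct A (i :: l)).2 (single k 1) = latRefl (fun i j => A j i) i y := by
    simp [pairRefl, hy]
  rcases posAt_or_negAt h (i :: l) k with hq | hq
  · have := IH _ ?_ (i :: l) hq ?_ rfl
    · rwa [c2, latRefl_apply_of_ne hji] at this
    · have hsum : ((latRefl A i x).sum fun _ c => c) = (x.sum fun _ c => c) - rowPairing A i x := by
        have e : ∀ u : I →₀ ℤ, (u.sum fun _ c => c) =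
            Finsupp.linearCombination ℤ (fun _ : I => (1 : ℤ)) u := fun u => by
          simp [Finsupp.linearCombination_apply]
        simp only [e, latRefl_apply, map_sub, map_smul, Finsupp.linearCombination_single]
        simp
      have hxs : 0 < x.sum fun _ c => c :=
        hxi.trans_le (Finset.single_le_sum (f := x) (fun j _ => hp'.1 j)
          (Finsupp.mem_support_iff.2 hxi.ne'))
      rw [c1, hsum, ← hn]
      omega
    · rw [c1, latRefl_apply_of_ne hji, hj]
  · have h1 := hq.2 j
    rw [c2, latRefl_apply_of_ne hji] at h1
    exact le_antisymm h1 (hp'.2 j)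

lemma wordAct_apply_of_notMem {k : I} {l : List I} (hk : k ∉ l) (x : I →₀ ℤ) :
    (wordAct A l).1 x k = x k := by
  induction l with
  | nil => simp
  | cons i l ih =>
    simp only [List.mem_cons, not_or] at hk
    simpa [pairRefl, latRefl_apply_of_ne hk.1] using ih hk.2

lemma posAt_of_notMem (h : IsGCM A) {k : I} {l : List I} (hk : k ∉ l) :
    PosAt (wordAct A l) k := by
  refine (posAt_or_negAt h l k).resolve_right fun hn => ?_
  have := hn.1 k
  rw [wordAct_apply_of_notMem hk] at this
  simp at this

end Lattice

section Realization

variable {I V : Type*} [AddCommGroup V] [Module ℚ V]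

open Classical in
/-- The generalized Cartan matrix obtained from a Borcherds-Cartan matrix by setting all diagonal
entries to `2`. -/
noncomputable def gcmOf (A : I → I → ℤ) (i j : I) : ℤ := if i = j then 2 else A i j

lemma isGCM_gcmOf {A : I → I → ℤ} (hoff : ∀ i j, i ≠ j → A i j ≤ 0)
    (hzero : ∀ i j, A i j = 0 ↔ A j i = 0) : IsGCM (gcmOf A) where
  diag i := by simp [gcmOf]
  off i j hij := by simpa [gcmOf, hij] using hoff i j hij
  zero i j := by
    by_cases hij : i = j
    · simp [gcmOf, hij]
    · simpa [gcmOf, hij, Ne.symm hij] using (hzero i j).1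

lemma gcmOf_row {A : I → I → ℤ} {i : I} (hi : A i i = 2) : gcmOf A i = A i := by
  ext j
  by_cases hij : i = j
  · subst hij; simp [gcmOf, hi]
  · simp [gcmOf, hij]

lemma gcmOf_col {A : I → I → ℤ} {i : I} (hi : A i i = 2) (j : I) : gcmOf A j i = A j i := by
  by_cases hij : j = i
  · subst hij; simp [gcmOf, hi]
  · simp [gcmOf, hij]

variable {A : I → I → ℤ} {α : I → V} {coroot : I → (V →ₗ[ℚ] ℚ)}

lemma srefl_apply (i : I) (x : V) : srefl α coroot i x = x - coroot i x • α i := by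
  simp [srefl]

lemma crefl_eq (i : I) (h : V →ₗ[ℚ] ℚ) : crefl α coroot i h = h - h (α i) • coroot i := by
  simp [crefl]

lemma crefl_apply (i : I) (h : V →ₗ[ℚ] ℚ) (x : V) :
    crefl α coroot i h x = h (srefl α coroot i x) := by
  simp only [crefl_eq, srefl_apply, LinearMap.sub_apply, LinearMap.smul_apply, map_sub, map_smul,
    smul_eq_mul]
  ring

lemma srefl_srefl (hpair : ∀ i j, coroot i (α j) = (A i j : ℚ)) {i : I} (hi : A i i = 2) (x : V) :
    srefl α coroot i (srefl α coroot i x) = x := by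
  simp only [srefl_apply, map_sub, map_smul, hpair, hi]
  push_cast
  module

lemma crefl_prod_srefl_prod (hpair : ∀ i j, coroot i (α j) = (A i j : ℚ)) (l : List I)
    (hl : ∀ m ∈ l, A m m = 2) (h : V →ₗ[ℚ] ℚ) (x : V) :
    (l.map (crefl α coroot)).prod h ((l.map (srefl α coroot)).prod x) = h x := by
  induction l with
  | nil => simp
  | cons i l ih =>
    simp only [List.map_cons, List.prod_cons, Module.End.mul_apply, crefl_apply]
    rw [srefl_srefl hpair (hl i (by simp)), ih fun m hm => hl m (by simp [hm])]

lemma crefl_reverse_prod_apply (l : List I) (h : V →ₗ[ℚ] ℚ) (x : V) :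
    (l.reverse.map (crefl α coroot)).prod h x = h ((l.map (srefl α coroot)).prod x) := by
  induction l generalizing h with
  | nil => simp
  | cons i l ih =>
    simp only [List.reverse_cons, List.map_append, List.prod_append, List.map_cons, List.map_nil,
      List.prod_cons, List.prod_nil, mul_one, Module.End.mul_apply, ih, crefl_apply]

lemma crefl_prod_reverse (hpair : ∀ i j, coroot i (α j) = (A i j : ℚ)) (l : List I)
    (hl : ∀ m ∈ l, A m m = 2) (h : V →ₗ[ℚ] ℚ) :
    (l.map (crefl α coroot)).prod ((l.reverse.map (crefl α coroot)).prod h) = h := by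
  ext x
  have h1 := crefl_reverse_prod_apply (α := α) (coroot := coroot) l.reverse
    ((l.reverse.map (crefl α coroot)).prod h) x
  rw [List.reverse_reverse] at h1
  rw [h1, crefl_prod_srefl_prod hpair _ (by simpa using hl)]

/-- The coroot of `r_β α_i`, where `β` is the root given by the word `l` and the index `k`. -/
lemma crefl_prod_conj (hpair : ∀ i j, coroot i (α j) = (A i j : ℚ)) (l : List I)
    (hl : ∀ m ∈ l, A m m = 2) (k : I) (h : V →ₗ[ℚ] ℚ) :
    ((l ++ k :: l.reverse).map (crefl α coroot)).prod h =
      h - h ((l.map (srefl α coroot)).prod (α k)) •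
        (l.map (crefl α coroot)).prod (coroot k) := by
  rw [List.map_append, List.prod_append, List.map_cons, List.prod_cons, Module.End.mul_apply,
    Module.End.mul_apply, crefl_eq, map_sub, map_smul, crefl_prod_reverse hpair l hl,
    crefl_reverse_prod_apply]

lemma srefl_prod_eq (hpair : ∀ i j, coroot i (α j) = (A i j : ℚ)) (l : List I)
    (hl : ∀ m ∈ l, A m m = 2) (k : I) :
    (l.map (srefl α coroot)).prod (α k) =
      Finsupp.linearCombination ℤ α ((wordAct (gcmOf A) l).1 (single k 1)) := by
  induction l with
  | nil => simp
  | cons i l ih =>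
    have hc : ∀ x : I →₀ ℤ, coroot i (Finsupp.linearCombination ℤ α x) =
        (rowPairing (gcmOf A) i x : ℚ) := fun x => by
      rw [rowPairing, gcmOf_row (hl i (by simp))]
      simp [Finsupp.linearCombination_apply, Finsupp.sum, hpair]
    simp only [List.map_cons, List.prod_cons, Module.End.mul_apply,
      ih fun m hm => hl m (by simp [hm]), srefl_apply, hc, wordAct_cons, Prod.fst_mul, pairRefl,
      latRefl_apply, map_sub, map_smul, Finsupp.linearCombination_single, one_smul,
      Int.cast_smul_eq_zsmul]

lemma linearCombination_coroot_apply (hpair : ∀ i j, coroot i (α j) = (A i j : ℚ)) (i : I)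
    (y : I →₀ ℤ) : Finsupp.linearCombination ℤ coroot y (α i) =
      ((y.sum fun j c => c * A j i : ℤ) : ℚ) := by
  simp [Finsupp.linearCombination_apply, Finsupp.sum, hpair, LinearMap.sum_apply]

lemma apply_linearCombination_root (hpair : ∀ i j, coroot i (α j) = (A i j : ℚ)) (i : I)
    (x : I →₀ ℤ) : coroot i (Finsupp.linearCombination ℤ α x) =
      ((x.sum fun j c => c * A i j : ℤ) : ℚ) := by
  simp [Finsupp.linearCombination_apply, Finsupp.sum, hpair]

lemma crefl_prod_eq (hpair : ∀ i j, coroot i (α j) = (A i j : ℚ)) (l : List I)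
    (hl : ∀ m ∈ l, A m m = 2) (k : I) :
    (l.map (crefl α coroot)).prod (coroot k) =
      Finsupp.linearCombination ℤ coroot ((wordAct (gcmOf A) l).2 (single k 1)) := by
  induction l with
  | nil => simp
  | cons i l ih =>
    have hc : ∀ y : I →₀ ℤ, Finsupp.linearCombination ℤ coroot y (α i) =
        (rowPairing (fun i j => gcmOf A j i) i y : ℚ) := fun y => by
      rw [linearCombination_coroot_apply hpair]
      simp [rowPairing, Finsupp.linearCombination_apply, gcmOf_col (hl i (by simp))]
    simp only [List.map_cons, List.prod_cons, Module.End.mul_apply,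
      ih fun m hm => hl m (by simp [hm]), crefl_eq, hc, wordAct_cons, Prod.snd_mul, pairRefl,
      latRefl_apply, map_sub, map_smul, Finsupp.linearCombination_single, one_smul,
      Int.cast_smul_eq_zsmul]

lemma linearCombination_coroot_nonneg {y : I →₀ ℤ} (hy : 0 ≤ y) {ν : V} (hν : ν ∈ Pplus coroot) :
    0 ≤ Finsupp.linearCombination ℤ coroot y ν := by
  rw [Finsupp.linearCombination_apply, Finsupp.sum, LinearMap.sum_apply]
  refine Finset.sum_nonneg fun j _ => ?_
  rw [LinearMap.smul_apply]
  exact smul_nonneg (hy j) (hν.2 j)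

/-- The coroots of imaginary roots are nonnegative on `T`-orbits of dominant weights. -/
theorem imaginary_coroot_nonneg (hpair : ∀ i j, coroot i (α j) = (A i j : ℚ))
    (hdiag : ∀ i, A i i = 2 ∨ A i i ≤ 0) (hoff : ∀ i j, i ≠ j → A i j ≤ 0)
    (hzero : ∀ i j, A i j = 0 ↔ A j i = 0) {ν : V} (hν : ν ∈ Pplus coroot)
    {τ : Module.End ℚ V} (hτ : τ ∈ Tmon α coroot) :
    ∀ (l : List I) (k : I), (∀ m ∈ l, A m m = 2) → A k k ≠ 2 →
      0 ≤ (l.map (crefl α coroot)).prod (coroot k) (τ ν) := by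
  have hpos : ∀ (l : List I) (k : I), (∀ m ∈ l, A m m = 2) → A k k ≠ 2 →
      0 ≤ (wordAct (gcmOf A) l).2 (single k 1) := fun l k hl hk =>
    (posAt_of_notMem (isGCM_gcmOf hoff hzero) fun hm => hk (hl k hm)).2
  induction hτ using Submonoid.closure_induction_left with
  | one =>
    intro l k hl hk
    rw [crefl_prod_eq hpair l hl]
    exact linearCombination_coroot_nonneg (hpos l k hl hk) hν
  | mul_left r hr τ _ ih =>
    obtain ⟨i, rfl⟩ := hr
    intro l k hl hk
    rw [Module.End.mul_apply]
    by_cases hi : A i i = 2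
    · have := ih (i :: l) k (by simpa [hi] using hl) hk
      simpa [crefl_apply] using this
    · have h1 := ih l k hl hk
      have h2 := ih [] i (by simp) hi
      have h3 : (l.map (crefl α coroot)).prod (coroot k) (α i) ≤ 0 := by
        rw [crefl_prod_eq hpair l hl, linearCombination_coroot_apply hpair]
        refine Int.cast_nonpos.2 (Finset.sum_nonpos fun j _ =>
          mul_nonpos_of_nonneg_of_nonpos (hpos l k hl hk j) ?_)
        by_cases hji : j = i
        · exact hji ▸ (hdiag i).resolve_left hi
        · exact hoff j i hji
      rw [srefl_apply, map_sub, map_smul, smul_eq_mul]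
      simp only [List.map_nil, List.prod_nil, Module.End.one_apply] at h2
      nlinarith [mul_nonneg h2 (neg_nonneg.2 h3)]

/-- For a positive root and an imaginary simple root, either the coroot vanishes on the latter or
both mutual pairings are at most `-1`. -/
lemma imaginary_pairing (hpair : ∀ i j, coroot i (α j) = (A i j : ℚ))
    (hdiag : ∀ i, A i i = 2 ∨ A i i ≤ 0) (hoff : ∀ i j, i ≠ j → A i j ≤ 0)
    (hzero : ∀ i j, A i j = 0 ↔ A j i = 0) {i : I} (hi : A i i ≠ 2) {x y : I →₀ ℤ}
    (hx : 0 ≤ x) (hy : 0 ≤ y) (hsupp : ∀ j, x j = 0 → y j = 0) :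
    Finsupp.linearCombination ℤ coroot y (α i) = 0 ∨
      (Finsupp.linearCombination ℤ coroot y (α i) ≤ -1 ∧
        coroot i (Finsupp.linearCombination ℤ α x) ≤ -1) := by
  rw [linearCombination_coroot_apply hpair, apply_linearCombination_root hpair]
  have hA : ∀ j, A j i ≤ 0 ∧ A i j ≤ 0 := fun j => by
    by_cases hji : j = i
    · subst hji; exact ⟨(hdiag j).resolve_left hi, (hdiag j).resolve_left hi⟩
    · exact ⟨hoff j i hji, hoff i j (Ne.symm hji)⟩
  have hny : ∀ j ∈ y.support, y j * A j i ≤ 0 := fun j _ =>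
    mul_nonpos_of_nonneg_of_nonpos (hy j) (hA j).1
  have hnx : ∀ j ∈ x.support, x j * A i j ≤ 0 := fun j _ =>
    mul_nonpos_of_nonneg_of_nonpos (hx j) (hA j).2
  by_cases h0 : ∀ j ∈ y.support, y j * A j i = 0
  · exact Or.inl (by rw [Finsupp.sum, Finset.sum_eq_zero h0, Int.cast_zero])
  push Not at h0
  obtain ⟨j, hj, hj0⟩ := h0
  have hAij : A i j ≠ 0 := fun h => hj0 (by rw [(hzero i j).1 h, mul_zero])
  have hxj : x j ≠ 0 := fun h => Finsupp.mem_support_iff.1 hj (hsupp j h)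
  have s1 : (y.sum fun j c => c * A j i) < 0 :=
    Finset.sum_neg' hny ⟨j, hj, lt_of_le_of_ne (hny j hj) hj0⟩
  have s2 : (x.sum fun j c => c * A i j) < 0 :=
    Finset.sum_neg' hnx ⟨j, Finsupp.mem_support_iff.2 hxj,
      lt_of_le_of_ne (hnx j (Finsupp.mem_support_iff.2 hxj)) (mul_ne_zero hxj hAij)⟩
  exact Or.inr ⟨by exact_mod_cast Int.le_sub_one_of_lt s1,
    by exact_mod_cast Int.le_sub_one_of_lt s2⟩

/-- For a root of either sign and an imaginary simple root, the two mutual pairings have the same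
sign, unless the coroot vanishes on the latter. -/
lemma exists_sign_pairing (hpair : ∀ i j, coroot i (α j) = (A i j : ℚ))
    (hdiag : ∀ i, A i i = 2 ∨ A i i ≤ 0) (hoff : ∀ i j, i ≠ j → A i j ≤ 0)
    (hzero : ∀ i j, A i j = 0 ↔ A j i = 0) {i : I} (hi : A i i ≠ 2) {l : List I}
    (hl : ∀ m ∈ l, A m m = 2) (k : I) :
    (l.map (crefl α coroot)).prod (coroot k) (α i) = 0 ∨
    ((l.map (crefl α coroot)).prod (coroot k) (α i) ≤ -1 ∧
      coroot i ((l.map (srefl α coroot)).prod (α k)) ≤ -1) ∨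
    (1 ≤ (l.map (crefl α coroot)).prod (coroot k) (α i) ∧
      1 ≤ coroot i ((l.map (srefl α coroot)).prod (α k))) := by
  have hG := isGCM_gcmOf hoff hzero
  rcases posAt_or_negAt hG l k with hp | hn
  · rw [crefl_prod_eq hpair l hl, srefl_prod_eq hpair l hl]
    exact (imaginary_pairing hpair hdiag hoff hzero hi hp.1 hp.2
      (coroot_support_subset hG l k hp)).imp_right Or.inl
  · have e1 : (wordAct (gcmOf A) (l ++ [k])).1 (single k 1) =
        -(wordAct (gcmOf A) l).1 (single k 1) := by
      simp [pairRefl, latRefl_single_self hG]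
    have e2 : (wordAct (gcmOf A) (l ++ [k])).2 (single k 1) =
        -(wordAct (gcmOf A) l).2 (single k 1) := by
      simp [pairRefl, latRefl_single_self hG.transpose]
    have hp : PosAt (wordAct (gcmOf A) (l ++ [k])) k := by
      unfold PosAt
      rw [e1, e2]
      simpa [NegAt] using hn
    have := imaginary_pairing hpair hdiag hoff hzero hi hp.1 hp.2
      (coroot_support_subset hG _ k hp)
    rw [e1, e2, map_neg, map_neg, map_neg, LinearMap.neg_apply, ← crefl_prod_eq hpair l hl,
      ← srefl_prod_eq hpair l hl] at this
    rcases this with h0 | ⟨h1, h2⟩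
    · exact Or.inl (neg_eq_zero.1 h0)
    · exact Or.inr (Or.inr ⟨by linarith, by linarith⟩)

/-- The coroot of a real root has constant sign on `{τ ν | ν ∈ P^+}`. -/
theorem real_coroot_sign (hpair : ∀ i j, coroot i (α j) = (A i j : ℚ))
    (hdiag : ∀ i, A i i = 2 ∨ A i i ≤ 0) (hoff : ∀ i j, i ≠ j → A i j ≤ 0)
    (hzero : ∀ i j, A i j = 0 ↔ A j i = 0) {τ : Module.End ℚ V} (hτ : τ ∈ Tmon α coroot) :
    ∀ (l : List I) (k : I), (∀ m ∈ l, A m m = 2) → A k k = 2 →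
      (∀ ν ∈ Pplus coroot, 0 ≤ (l.map (crefl α coroot)).prod (coroot k) (τ ν)) ∨
      (∀ ν ∈ Pplus coroot, (l.map (crefl α coroot)).prod (coroot k) (τ ν) ≤ 0) := by
  induction hτ using Submonoid.closure_induction_left with
  | one =>
    intro l k hl hk
    rw [crefl_prod_eq hpair l hl]
    refine (posAt_or_negAt (isGCM_gcmOf hoff hzero) l k).imp
      (fun h ν hν => linearCombination_coroot_nonneg h.2 hν) fun h ν hν => ?_
    have := linearCombination_coroot_nonneg (neg_nonneg.2 h.2) hν
    rwa [map_neg, LinearMap.neg_apply, neg_nonneg] at this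
  | mul_left r hr τ hτ ih =>
    obtain ⟨i, rfl⟩ := hr
    intro l k hl hk
    by_cases hi : A i i = 2
    · have := ih (i :: l) k (by simpa [hi] using hl) hk
      simpa [crefl_apply] using this
    have himag := fun ν (hν : ν ∈ Pplus coroot) =>
      imaginary_coroot_nonneg hpair hdiag hoff hzero hν hτ
    have h1 : ∀ ν ∈ Pplus coroot, 0 ≤ coroot i (τ ν) := fun ν hν => by
      simpa using himag ν hν [] i (by simp) hi
    have h2 : ∀ ν ∈ Pplus coroot, 0 ≤ coroot i (τ ν) -
        coroot i ((l.map (srefl α coroot)).prod (α k)) *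
          (l.map (crefl α coroot)).prod (coroot k) (τ ν) := fun ν hν => by
      have := himag ν hν (l ++ k :: l.reverse) i
        (by
          intro m hm
          simp only [List.mem_append, List.mem_cons, List.mem_reverse] at hm
          rcases hm with hm | rfl | hm
          exacts [hl m hm, hk, hl m hm]) hi
      rwa [crefl_prod_conj hpair l hl, LinearMap.sub_apply, LinearMap.smul_apply,
        smul_eq_mul] at this
    simp only [Module.End.mul_apply, srefl_apply, map_sub, map_smul, smul_eq_mul]
    have hih := ih l k hl hk
    have hsign := exists_sign_pairing hpair hdiag hoff hzero hi hl k
    generalize (l.map (crefl α coroot)).prod (coroot k) = βv at *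
    generalize (l.map (srefl α coroot)).prod (α k) = β at *
    rcases hsign with h0 | ⟨hc, hd⟩ | ⟨hc, hd⟩
    · simpa [h0] using hih
    · refine Or.inl fun ν hν => ?_
      have g0 := h1 ν hν
      have g1 := h2 ν hν
      rcases le_total 0 (βv (τ ν)) with hf | hf <;> nlinarith
    · refine Or.inr fun ν hν => ?_
      have g0 := h1 ν hν
      have g1 := h2 ν hν
      rcases le_total 0 (βv (τ ν)) with hf | hf <;> nlinarith

end Realization

end GKM

open GKM in
/-- For `λ, μ ∈ P^+` and `τ ∈ T`: `β^∨(τμ) > 0` implies `β^∨(τλ) ≥ 0` for every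
`β ∈ WΠ ∩ Q^+`. -/
theorem stmt11 {I V : Type*} [Countable I] [AddCommGroup V] [Module ℚ V]
    (A : I → I → ℤ) (α : I → V) (coroot : I → (V →ₗ[ℚ] ℚ))
    (hind : LinearIndependent ℚ α)
    (hpair : ∀ i j, coroot i (α j) = (A i j : ℚ))
    (hdiag : ∀ i, A i i = 2 ∨ A i i ≤ 0)
    (hoff : ∀ i j, i ≠ j → A i j ≤ 0)
    (hzero : ∀ i j, A i j = 0 ↔ A j i = 0)
    (lam μ : V) (hlam : lam ∈ Pplus coroot) (hμ : μ ∈ Pplus coroot)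
    (τ : Module.End ℚ V) (hτ : τ ∈ Tmon α coroot) :
    ∀ (β : V) (βv : V →ₗ[ℚ] ℚ), IsWRootPair A α coroot β βv → β ∈ Qplus α →
      0 < βv (τ μ) → 0 ≤ βv (τ lam) := by
  rintro β βv ⟨l, k, hl, -, rfl⟩ - hpos
  by_cases hk : A k k = 2
  · rcases real_coroot_sign hpair hdiag hoff hzero hτ l k hl hk with h | h
    · exact h lam hlam
    · exact absurd (h μ hμ) (not_le.2 hpos)
  · exact imaginary_coroot_nonneg hpair hdiag hoff hzero hlam hτ l k hl hk
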